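/- Let G be a connected graph, A, B ⊆ V(G) disjoint, and A' a co-connected closure of A. If the complement of B is connected then the complement of B∖A' is connected. -/

import Mathlib

open scoped Classical

/-- Adjacency within a set `U`: both endpoints lie in `U` and they are adjacent in `G`. -/
def within {V : Type*} (G : SimpleGraph V) (U : Set V) (x y : V) : Prop :=
  G.Adj x y ∧ x ∈ U ∧ y ∈ U

/-- The co-connected closure of `A` with respect to `v`: the complement of the connected
component of `V ∖ A` containing `v` (all of `V` if `v ∈ A`). -/
def coClosure {V : Type*} (G : SimpleGraph V) (A : Set V) (v : V) : Set V :=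
  if v ∈ A then Set.univ
  else {w | Relation.ReflTransGen (within G Aᶜ) v w}ᶜ

theorem mem_coClosure_of_adj {V : Type*} {G : SimpleGraph V} {A : Set V} {v w y : V}
    (hw : w ∈ coClosure G A v) (hwA : w ∉ A) (h : G.Adj w y) : y ∈ coClosure G A v := by
  unfold coClosure at *
  split_ifs at * with hv
  · trivial
  · intro hy
    have hyA : y ∉ A := by
      rcases Relation.ReflTransGen.cases_tail hy with rfl | ⟨_, _, hb⟩
      exacts [hv, hb.2.2]
    exact hw (Relation.ReflTransGen.tail hy ⟨h.symm, hyA, hwA⟩)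

/-- If every vertex of `S ∖ T` has all its neighbours in `S`, then a vertex of `S` joined to
`T` by a walk in `G` is already joined to `T` inside `S`. -/
theorem SimpleGraph.Walk.exists_reachable_induce {V : Type*} {G : SimpleGraph V} {S T : Set V}
    (hTS : T ⊆ S) (hS : ∀ w ∈ S, w ∉ T → ∀ y, G.Adj w y → y ∈ S) {w u : V} (p : G.Walk w u)
    (hu : u ∈ T) (hw : w ∈ S) :
    ∃ t, ∃ ht : t ∈ T, (G.induce S).Reachable ⟨w, hw⟩ ⟨t, hTS ht⟩ := by
  induction p with
  | nil => exact ⟨_, hu, .rfl⟩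
  | @cons w y _ h _ ih =>
    by_cases hwT : w ∈ T
    · exact ⟨w, hwT, .rfl⟩
    · have hy := hS w hw hwT y h
      obtain ⟨t, ht, hr⟩ := ih hu hy
      have hadj : (G.induce S).Adj ⟨w, hw⟩ ⟨y, hy⟩ := h
      exact ⟨t, ht, hadj.reachable.trans hr⟩

/-- For a connected graph `G`, disjoint `A, B ⊆ V(G)`, and `A'` a co-connected
closure of `A`: if `B` is co-connected (its complement induces a connected subgraph),
then `B ∖ A'` is co-connected as well. -/
theorem coClosure_coconnected {V : Type*} (G : SimpleGraph V) (hG : G.Connected)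
    (A B : Set V) (hAB : Disjoint A B) (v : V) (A' : Set V) (hA' : A' = coClosure G A v)
    (hBc : (G.induce Bᶜ).Connected) :
    (G.induce (B \ A')ᶜ).Connected := by
  subst hA'
  have hTS : Bᶜ ⊆ (B \ coClosure G A v)ᶜ := fun x hx h => hx h.1
  have hS : ∀ w ∈ (B \ coClosure G A v)ᶜ, w ∉ Bᶜ → ∀ y, G.Adj w y →
      y ∈ (B \ coClosure G A v)ᶜ := by
    intro w hw hwB y h hy
    have hwB' : w ∈ B := not_not.mp hwB
    have hwA' : w ∈ coClosure G A v := by_contra fun hn => hw ⟨hwB', hn⟩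
    exact hy.2 (mem_coClosure_of_adj hwA' (fun hA => hAB.notMem_of_mem_left hA hwB') h)
  obtain ⟨b, hb⟩ := hBc.nonempty
  refine SimpleGraph.connected_iff_exists_forall_reachable _ |>.mpr ⟨⟨b, hTS hb⟩, ?_⟩
  rintro ⟨w, hw⟩
  obtain ⟨p⟩ := hG.preconnected w b
  obtain ⟨t, ht, hr⟩ := p.exists_reachable_induce hTS hS hb hw
  exact ((hBc.preconnected ⟨b, hb⟩ ⟨t, ht⟩).map
    (SimpleGraph.induceHomOfLE G hTS).toHom).trans hr.symm
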